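/- arXiv:1410.5088 — 4 statements merged into one kernel-verified Lean document; each statement's English description precedes it below -/
import Mathlib

section
/- Let V be a finite set, succ : V → Option V a partial successor function, and N ⊆ V a subset (the labelled vertices). Suppose every vertex u ∈ V \ N has at least two predecessors, i.e. the set {v ∈ V | succ v = some u} has cardinality at least 2. Then |V \ N| ≤ |N|, and consequently |V| ≤ 2·|N|. -/
/-- Counting core of the paper's Lemma "Kernels are Small": in a finite partial
functional graph, if every vertex outside the labelled set `N` has at least two
predecessors, then there are at most as many unlabelled vertices as labelled
ones, so `|V| ≤ 2·|N|`. -/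
theorem kernels_are_small {V : Type} [Fintype V] [DecidableEq V]
    (succ : V → Option V) (N : Finset V)
    (h : ∀ u : V, u ∉ N →
      2 ≤ (Finset.univ.filter (fun v => succ v = some u)).card) :
    (Finset.univ \ N).card ≤ N.card ∧ Fintype.card V ≤ 2 * N.card := by
  have hdisj : ((Finset.univ \ N : Finset V) : Set V).PairwiseDisjoint
      (fun u => Finset.univ.filter (fun v => succ v = some u)) := by
    intro a _ b _ hab
    refine Finset.disjoint_left.mpr fun v hva hvb => hab ?_
    exact Option.some.inj
      ((Finset.mem_filter.mp hva).2.symm.trans (Finset.mem_filter.mp hvb).2)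
  have hcount : (Finset.univ \ N).card * 2 ≤ Fintype.card V :=
    calc (Finset.univ \ N).card * 2
        ≤ ∑ u ∈ Finset.univ \ N, (Finset.univ.filter (fun v => succ v = some u)).card :=
          Finset.card_nsmul_le_sum _ _ _ fun u hu => h u (Finset.mem_sdiff.mp hu).2
      _ = ((Finset.univ \ N).biUnion
            fun u => Finset.univ.filter (fun v => succ v = some u)).card :=
          (Finset.card_biUnion hdisj).symm
      _ ≤ Fintype.card V := Finset.card_le_univ _
  have hsplit : (Finset.univ \ N).card + N.card = Fintype.card V :=
    Finset.card_sdiff_add_card_eq_card (Finset.subset_univ N)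
  omega
end

section
/- If a heap H' over P is obtained from a heap H over P by a single-edge subdivision, then for all vertices x, y of H: pathLength(H, x, y) = pathLength(H', x, y), and circular(H, x) holds if and only if circular(H', x) holds. -/
/-- A heap over pointer variables `P`: a finite set `V` of vertices (drawn from `ℕ`),
a partial successor function `succ` (with `succ v = none` outside `V`),
an edge-weight function `wt` (weights are at least 1 on actual edges),
and a labelling `L` of pointer variables by vertices. -/
structure Heap (P : Type) where
  V : Finset ℕ
  succ : ℕ → Option ℕ
  wt : ℕ → ℕ
  L : P → ℕ
  label_mem : ∀ p, L p ∈ V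
  succ_mem : ∀ v ∈ V, ∀ u, succ v = some u → u ∈ V
  succ_dom : ∀ v, v ∉ V → succ v = none
  wt_pos : ∀ v ∈ V, succ v ≠ none → 1 ≤ wt v

namespace Heap

variable {P : Type}

/-- `vs` is a walk from `x` to `y`: a nonempty list of vertices starting at `x`,
ending at `y`, where each vertex's successor is the next list element. -/
def IsWalk (H : Heap P) (x y : ℕ) (vs : List ℕ) : Prop :=
  vs.head? = some x ∧ vs.getLast? = some y ∧
    List.Chain' (fun a b => H.succ a = some b) vs

/-- The weight of a walk: the sum of the weights of its edges,
i.e. of `wt vᵢ` over all but the last vertex. -/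
def walkWeight (H : Heap P) (vs : List ℕ) : ℕ :=
  (vs.dropLast.map H.wt).sum

/-- `pathLength H x y ∈ ℕ ∪ {∞}`: the least weight of a walk from `x` to `y`,
and `∞` if there is no walk. -/
noncomputable def pathLength (H : Heap P) (x y : ℕ) : ℕ∞ :=
  sInf {n : ℕ∞ | ∃ vs : List ℕ, H.IsWalk x y vs ∧ n = (H.walkWeight vs : ℕ∞)}

/-- `x` lies on a cycle: there is a walk from `x` to `x` with at least one step. -/
def Circular (H : Heap P) (x : ℕ) : Prop :=
  ∃ vs : List ℕ, H.IsWalk x x vs ∧ 2 ≤ vs.length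

/-- A vertex is reachable if some labelled vertex reaches it by following successors. -/
def Reachable (H : Heap P) (v : ℕ) : Prop :=
  ∃ p : P, Relation.ReflTransGen (fun a b => H.succ a = some b) (H.L p) v

/-- `H'` is obtained from `H` by a single-edge subdivision: the edge from `u`
(with `succ u = some v` and weight `n ≥ 2`) is split, for some `1 ≤ k < n`, by a
fresh vertex `q` into an edge `u → q` of weight `k` and an edge `q → v` of weight
`n - k`; everything else is unchanged. -/
def SingleSubdiv (H H' : Heap P) : Prop :=
  ∃ u v q k : ℕ,
    u ∈ H.V ∧ H.succ u = some v ∧ 2 ≤ H.wt u ∧ 1 ≤ k ∧ k < H.wt u ∧ q ∉ H.V ∧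
    H'.V = insert q H.V ∧
    H'.succ = Function.update (Function.update H.succ u (some q)) q (some v) ∧
    H'.wt = Function.update (Function.update H.wt u k) q (H.wt u - k) ∧
    H'.L = H.L

/-- `H'` is a subdivision of `H`: it is obtained from `H` by a finite (possibly
empty) sequence of single-edge subdivisions. -/
def Subdiv (H H' : Heap P) : Prop :=
  Relation.ReflTransGen SingleSubdiv H H'

/-- Heap isomorphism: a bijection between the reachable vertices that respects
labels, successors and weights. -/
def Iso (H H' : Heap P) : Prop :=
  ∃ f : ℕ → ℕ,
    Set.BijOn f {v | H.Reachable v} {v | H'.Reachable v} ∧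
    (∀ p, f (H.L p) = H'.L p) ∧
    (∀ v, H.Reachable v → H'.succ (f v) = Option.map f (H.succ v)) ∧
    (∀ v, H.Reachable v → H.succ v ≠ none → H'.wt (f v) = H.wt v)

/-- Heap homeomorphism: some subdivision of `H` is isomorphic to some
subdivision of `H'`. -/
def Homeo (H H' : Heap P) : Prop :=
  ∃ S S' : Heap P, H.Subdiv S ∧ H'.Subdiv S' ∧ Iso S S'

end Heap

namespace Heap

/-- There is a walk of weight `w` from `x` to `y`. -/
inductive HasWalk {P : Type} (H : Heap P) (y : ℕ) : ℕ → ℕ → Prop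
  | nil : HasWalk H y y 0
  | cons {x z w : ℕ} : H.succ x = some z → HasWalk H y z w → HasWalk H y x (H.wt x + w)

theorem mem_of_succ {P : Type} (H : Heap P) {x z : ℕ} (h : H.succ x = some z) : x ∈ H.V := by
  by_contra hx
  simp [H.succ_dom x hx] at h

theorem wt_pos_of_succ {P : Type} (H : Heap P) {x z : ℕ} (h : H.succ x = some z) :
    0 < H.wt x :=
  H.wt_pos x (H.mem_of_succ h) (by simp [h])

theorem IsWalk.hasWalk {P : Type} {H : Heap P} {y : ℕ} {vs : List ℕ} :
    ∀ {x : ℕ}, H.IsWalk x y vs → H.HasWalk y x (H.walkWeight vs) := by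
  induction vs with
  | nil => intro x h; simp [IsWalk] at h
  | cons a l ih =>
    rintro x ⟨hx, hy, hc⟩
    obtain rfl : a = x := by simpa using hx
    cases l with
    | nil =>
      obtain rfl : a = y := by simpa using hy
      exact .nil
    | cons b l =>
      obtain ⟨hab, hc⟩ := List.isChain_cons_cons.mp hc
      simpa [walkWeight] using
        HasWalk.cons hab (ih ⟨rfl, by simpa [List.getLast?_cons_cons] using hy, hc⟩)

theorem HasWalk.exists_isWalk {P : Type} {H : Heap P} {x y w : ℕ} (h : H.HasWalk y x w) :
    ∃ vs, H.IsWalk x y vs ∧ H.walkWeight vs = w := by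
  induction h with
  | nil => exact ⟨[y], ⟨rfl, rfl, .singleton y⟩, rfl⟩
  | @cons x z w hxz _ ih =>
    obtain ⟨vs, ⟨hz, hy, hc⟩, rfl⟩ := ih
    cases vs with
    | nil => simp at hz
    | cons a l =>
      obtain rfl : a = z := by simpa using hz
      exact ⟨x :: a :: l, ⟨rfl, by simpa [List.getLast?_cons_cons] using hy,
        List.isChain_cons_cons.mpr ⟨hxz, hc⟩⟩, by simp [walkWeight]⟩

theorem hasWalk_iff {P : Type} {H : Heap P} {x y w : ℕ} :
    H.HasWalk y x w ↔ ∃ vs, H.IsWalk x y vs ∧ H.walkWeight vs = w :=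
  ⟨HasWalk.exists_isWalk, by rintro ⟨vs, h, rfl⟩; exact h.hasWalk⟩

theorem pathLength_eq_sInf_hasWalk {P : Type} (H : Heap P) (x y : ℕ) :
    H.pathLength x y = sInf {n : ℕ∞ | ∃ w : ℕ, H.HasWalk y x w ∧ n = w} := by
  simp only [pathLength, hasWalk_iff]
  congr 1
  ext n
  constructor
  · rintro ⟨vs, h, rfl⟩
    exact ⟨_, ⟨vs, h, rfl⟩, rfl⟩
  · rintro ⟨_, ⟨vs, h, rfl⟩, rfl⟩
    exact ⟨vs, h, rfl⟩

theorem IsWalk.two_le_length_iff {P : Type} {H : Heap P} {x y : ℕ} {vs : List ℕ}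
    (h : H.IsWalk x y vs) : 2 ≤ vs.length ↔ 0 < H.walkWeight vs := by
  obtain ⟨-, -, hc⟩ := h
  match vs, hc with
  | [], _ => simp [walkWeight]
  | [_], _ => simp [walkWeight]
  | a :: b :: l, hc =>
    have := H.wt_pos_of_succ (List.isChain_cons_cons.mp hc).1
    simp [walkWeight]
    omega

theorem circular_iff_hasWalk {P : Type} {H : Heap P} {x : ℕ} :
    H.Circular x ↔ ∃ w, H.HasWalk x x w ∧ 0 < w := by
  simp only [Circular, hasWalk_iff]
  constructor
  · rintro ⟨vs, h, hl⟩
    exact ⟨_, ⟨vs, h, rfl⟩, h.two_le_length_iff.mp hl⟩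
  · rintro ⟨_, ⟨vs, h, rfl⟩, hw⟩
    exact ⟨vs, h, h.two_le_length_iff.mpr hw⟩

/-- Subdividing an edge preserves the weights of the walks between old vertices. -/
theorem SingleSubdiv.hasWalk_iff {P : Type} {H H' : Heap P} (h : H.SingleSubdiv H')
    {x y w : ℕ} (hx : x ∈ H.V) (hy : y ∈ H.V) : H.HasWalk y x w ↔ H'.HasWalk y x w := by
  obtain ⟨u, v, q, k, hu, huv, -, -, hk, hq, -, hsucc, hwt, -⟩ := h
  have huq : u ≠ q := fun e => hq (e ▸ hu)
  have hsu : H'.succ u = some q := by simp [hsucc, huq]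
  have hsq : H'.succ q = some v := by simp [hsucc]
  have hwu : H'.wt u = k := by simp [hwt, huq]
  have hwq : H'.wt q = H.wt u - k := by simp [hwt]
  have hs {a : ℕ} (hau : a ≠ u) (haq : a ≠ q) : H'.succ a = H.succ a := by
    simp [hsucc, hau, haq]
  have hw {a : ℕ} (hau : a ≠ u) (haq : a ≠ q) : H'.wt a = H.wt a := by
    simp [hwt, hau, haq]
  constructor
  · intro hwalk
    clear hx
    induction hwalk with
    | nil => exact .nil
    | @cons a b w hab _ ih =>
      have haq : a ≠ q := fun e => hq (e ▸ H.mem_of_succ hab)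
      by_cases hau : a = u
      · subst hau
        obtain rfl : v = b := by simpa [huv] using hab
        have hwalk := HasWalk.cons hsu (HasWalk.cons hsq ih)
        rwa [hwu, hwq, ← add_assoc, Nat.add_sub_cancel' hk.le] at hwalk
      · rw [← hw hau haq]
        exact .cons ((hs hau haq).trans hab) ih
  · intro hwalk
    -- A walk from the fresh vertex is the tail of a walk over the subdivided edge.
    suffices (x ∈ H.V → H.HasWalk y x w) ∧
        (x = q → ∃ w', H.HasWalk y v w' ∧ w = (H.wt u - k) + w') from this.1 hx
    clear hx
    induction hwalk with
    | nil => exact ⟨fun _ => .nil, fun e => absurd (e ▸ hy) hq⟩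
    | @cons a b w hab _ ih =>
      constructor
      · intro ha
        have haq : a ≠ q := fun e => hq (e ▸ ha)
        by_cases hau : a = u
        · subst hau
          obtain rfl : q = b := by simpa [hsu] using hab
          obtain ⟨w', hw', rfl⟩ := ih.2 rfl
          rw [hwu, ← add_assoc, Nat.add_sub_cancel' hk.le]
          exact .cons huv hw'
        · rw [hs hau haq] at hab
          rw [hw hau haq]
          exact .cons hab (ih.1 (H.succ_mem a ha b hab))
      · rintro rfl
        obtain rfl : v = b := by simpa [hsq] using hab
        exact ⟨w, ih.1 (H.succ_mem u hu v huv), by rw [hwq]⟩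

end Heap

/-- Subdividing a single edge preserves observations: path lengths between
vertices of the original heap, and circularity. -/
theorem singleSubdiv_preserves_observations {P : Type} (H H' : Heap P)
    (h : H.SingleSubdiv H') :
    (∀ x ∈ H.V, ∀ y ∈ H.V, H.pathLength x y = H'.pathLength x y) ∧
    (∀ x ∈ H.V, (H.Circular x ↔ H'.Circular x)) := by
  refine ⟨fun x hx y hy => ?_, fun x hx => ?_⟩
  · simp only [Heap.pathLength_eq_sInf_hasWalk, h.hasWalk_iff hx hy]
  · simp only [Heap.circular_iff_hasWalk, h.hasWalk_iff hx hx]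
end

section
/- Let H₁ and H₂ be homeomorphic heaps over P, and let x, y ∈ P be pointer variables such that succ(L₁ y) ≠ none in H₁ and succ(L₂ y) ≠ none in H₂. Then lookup(H₁, x, y) and lookup(H₂, x, y) are homeomorphic. -/
/-- The transformer `lookup(H, x, y)`, defined when `succ (L y) = some u`:
if the edge out of `L y` has weight 1, relabel `x` to `u`; otherwise first
subdivide that edge with split `k = 1` (fresh vertex `q`) and relabel `x` to `q`. -/
def Heap.IsLookup {P : Type} [DecidableEq P] (H : Heap P) (x y : P) (H' : Heap P) : Prop :=
  ∃ u : ℕ, H.succ (H.L y) = some u ∧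
    ((H.wt (H.L y) = 1 ∧
        H'.V = H.V ∧ H'.succ = H.succ ∧ H'.wt = H.wt ∧
        H'.L = Function.update H.L x u) ∨
     (2 ≤ H.wt (H.L y) ∧ ∃ q : ℕ, q ∉ H.V ∧
        H'.V = insert q H.V ∧
        H'.succ = Function.update (Function.update H.succ (H.L y) (some q)) q (some u) ∧
        H'.wt = Function.update (Function.update H.wt (H.L y) 1) q (H.wt (H.L y) - 1) ∧
        H'.L = Function.update H.L x q))

namespace Heap

variable {P : Type}

/-- One unit step in the unit-weight expansion of `H`, whose state `(v, i)` is the point at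
distance `i` from `v` along the edge leaving `v`. -/
def unitStep (H : Heap P) (s : ℕ × ℕ) : Option (ℕ × ℕ) :=
  (H.succ s.1).map fun u => if s.2 + 1 < H.wt s.1 then (s.1, s.2 + 1) else (u, 0)

/-- The state reached from `s` after `n` unit steps, if any. -/
def unitWalk (H : Heap P) (s : ℕ × ℕ) : ℕ → Option (ℕ × ℕ)
  | 0 => some s
  | n + 1 => (H.unitWalk s n).bind H.unitStep

/-- The state at which the pointer variable `p` points. -/
def start (H : Heap P) (p : P) : ℕ × ℕ := (H.L p, 0)

/-- The families `a` and `a'` of states have the same pattern of termination and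
of coincidences among their unit walks. -/
def SameWalks (H : Heap P) (a : P → ℕ × ℕ) (H' : Heap P) (a' : P → ℕ × ℕ) : Prop :=
  (∀ p m q n, H.unitWalk (a p) m = H.unitWalk (a q) n ↔
    H'.unitWalk (a' p) m = H'.unitWalk (a' q) n) ∧
  ∀ p m, H.unitWalk (a p) m = none ↔ H'.unitWalk (a' p) m = none

theorem SameWalks.symm {H H' : Heap P} {a a' : P → ℕ × ℕ} (h : SameWalks H a H' a') :
    SameWalks H' a' H a :=
  ⟨fun p m q n => (h.1 p m q n).symm, fun p m => (h.2 p m).symm⟩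

theorem SameWalks.trans {H H' H'' : Heap P} {a a' a'' : P → ℕ × ℕ}
    (h : SameWalks H a H' a') (h' : SameWalks H' a' H'' a'') : SameWalks H a H'' a'' :=
  ⟨fun p m q n => (h.1 p m q n).trans (h'.1 p m q n), fun p m => (h.2 p m).trans (h'.2 p m)⟩

theorem unitWalk_succ_of_unitStep {H : Heap P} {s t : ℕ × ℕ} (h : H.unitStep s = some t)
    (n : ℕ) : H.unitWalk s (n + 1) = H.unitWalk t n := by
  induction n with
  | zero => simp [unitWalk, h]
  | succ n ih => rw [unitWalk, ih, unitWalk]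

theorem unitWalk_mem {H : Heap P} {W : Set (ℕ × ℕ)}
    (hW : ∀ s ∈ W, ∀ t, H.unitStep s = some t → t ∈ W) {s : ℕ × ℕ} (hs : s ∈ W) :
    ∀ n t, H.unitWalk s n = some t → t ∈ W := by
  intro n
  induction n with
  | zero => intro t ht; cases ht; exact hs
  | succ n ih =>
    intro t ht
    obtain ⟨r, hr, hrt⟩ := Option.bind_eq_some_iff.1 ht
    exact hW r (ih r hr) t hrt

/-- A map of states that is injective on a closed set of states and commutes with unit steps
there preserves the pattern of unit walks. -/
theorem sameWalks_of_map {H H' : Heap P} {W : Set (ℕ × ℕ)} {g : ℕ × ℕ → ℕ × ℕ}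
    (hg : Set.InjOn g W) (hW : ∀ s ∈ W, ∀ t, H.unitStep s = some t → t ∈ W)
    (hstep : ∀ s ∈ W, H'.unitStep (g s) = (H.unitStep s).map g)
    {a a' : P → ℕ × ℕ} (ha : ∀ p, a p ∈ W) (ha' : ∀ p, a' p = g (a p)) :
    SameWalks H a H' a' := by
  have hmap : ∀ p n, H'.unitWalk (a' p) n = (H.unitWalk (a p) n).map g := by
    intro p n
    induction n with
    | zero => simp [unitWalk, ha']
    | succ n ih =>
      rw [unitWalk, ih, unitWalk]
      cases h : H.unitWalk (a p) n with
      | none => rfl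
      | some t => exact hstep t (unitWalk_mem hW (ha p) n t h)
  refine ⟨fun p m q n => ?_, fun p m => ?_⟩
  · rw [hmap, hmap]
    cases h : H.unitWalk (a p) m with
    | none => cases h' : H.unitWalk (a q) n <;> simp
    | some s =>
      cases h' : H.unitWalk (a q) n with
      | none => simp
      | some t =>
        simpa using (hg.eq_iff (unitWalk_mem hW (ha p) m s h)
          (unitWalk_mem hW (ha q) n t h')).symm
  · rw [hmap]; simp

theorem unitStep_mem_vertices {H : Heap P} {s t : ℕ × ℕ} (hs : s.1 ∈ H.V)
    (h : H.unitStep s = some t) : t.1 ∈ H.V := by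
  obtain ⟨u, hu, rfl⟩ := Option.map_eq_some_iff.1 h
  split_ifs
  · exact hs
  · exact H.succ_mem _ hs _ hu

/-- The effect on states of splitting the edge leaving `u` at distance `k` by the vertex `q`. -/
def splitState (u q k : ℕ) (s : ℕ × ℕ) : ℕ × ℕ :=
  if s.1 = u ∧ k ≤ s.2 then (q, s.2 - k) else s

/-- Splitting an edge preserves the pattern of unit walks, regardless of labels. -/
theorem sameWalks_of_split {H H' : Heap P} {u v q k : ℕ} (hu : u ∈ H.V)
    (huv : H.succ u = some v) (hk : 1 ≤ k) (hkw : k < H.wt u) (hq : q ∉ H.V)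
    (hsucc : H'.succ = Function.update (Function.update H.succ u (some q)) q (some v))
    (hwt : H'.wt = Function.update (Function.update H.wt u k) q (H.wt u - k))
    {a a' : P → ℕ × ℕ} (ha : ∀ p, (a p).1 ∈ H.V) (ha' : ∀ p, a' p = splitState u q k (a p)) :
    SameWalks H a H' a' := by
  have huq : u ≠ q := fun h => hq (h ▸ hu)
  refine sameWalks_of_map (W := {s | s.1 ∈ H.V}) (g := splitState u q k) ?_
    (fun s hs t ht => unitStep_mem_vertices hs ht) ?_ ha ha'
  · rintro ⟨v₁, i⟩ h₁ ⟨v₂, j⟩ h₂ h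
    have h₁q : v₁ ≠ q := fun e => hq (e ▸ h₁)
    have h₂q : v₂ ≠ q := fun e => hq (e ▸ h₂)
    simp only [splitState] at h
    split_ifs at h <;> simp only [Prod.mk.injEq] at h ⊢ <;> omega
  · rintro ⟨w, i⟩ hw
    have hwq : w ≠ q := fun e => hq (e ▸ hw)
    by_cases hwu : w = u
    · subst hwu
      by_cases hi : k ≤ i
      · have hlt : i - k + 1 < H.wt w - k ↔ i + 1 < H.wt w := by omega
        have hsub : i - k + 1 = i + 1 - k := by omega
        by_cases hi' : i + 1 < H.wt w
        · have : k ≤ i + 1 := by omega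
          simp [unitStep, splitState, hsucc, hwt, huv, hi, hi', hsub, this]
        · have : k ≠ 0 := by omega
          simp [unitStep, splitState, hsucc, hwt, huv, hi, hlt, hi', this]
      · have hi' : i + 1 < H.wt w := by omega
        by_cases hik : i + 1 < k
        · simp [unitStep, splitState, hsucc, hwt, huv, hi, hi', hik, huq, hik.not_ge]
        · have : i + 1 = k := by omega
          simp [unitStep, splitState, hsucc, hwt, huv, hi, huq, this, hkw]
    · have : k ≠ 0 := by omega
      cases hs : H.succ w with
      | none => simp [unitStep, splitState, hsucc, hwu, hwq, hs]
      | some z =>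
        by_cases hi : i + 1 < H.wt w <;>
          simp [unitStep, splitState, hsucc, hwt, hwu, hwq, hs, hi, this]

theorem SingleSubdiv.sameWalks {H H' : Heap P} (h : SingleSubdiv H H') :
    SameWalks H H.start H' H'.start := by
  obtain ⟨u, v, q, k, hu, huv, -, hk, hkw, hq, -, hsucc, hwt, hL⟩ := h
  refine sameWalks_of_split hu huv hk hkw hq hsucc hwt (fun p => H.label_mem p) fun p => ?_
  have : k ≠ 0 := by omega
  simp [start, splitState, hL, this]

theorem Subdiv.sameWalks {H H' : Heap P} (h : Subdiv H H') :
    SameWalks H H.start H' H'.start := by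
  induction h with
  | refl => exact ⟨fun _ _ _ _ => Iff.rfl, fun _ _ => Iff.rfl⟩
  | tail _ h ih => exact ih.trans h.sameWalks

theorem Iso.sameWalks {H H' : Heap P} (h : Iso H H') : SameWalks H H.start H' H'.start := by
  obtain ⟨f, hf, hL, hsucc, hwt⟩ := h
  refine sameWalks_of_map (W := {s | H.Reachable s.1}) (g := fun s => (f s.1, s.2)) ?_ ?_ ?_
    (fun p => ⟨p, .refl⟩) fun p => by simp [start, hL]
  · rintro ⟨v, i⟩ hv ⟨w, j⟩ hw h
    simp only [Prod.mk.injEq] at h ⊢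
    exact ⟨hf.injOn hv hw h.1, h.2⟩
  · rintro ⟨v, i⟩ ⟨p, hp⟩ t ht
    obtain ⟨u, hu, rfl⟩ := Option.map_eq_some_iff.1 ht
    split_ifs
    · exact ⟨p, hp⟩
    · exact ⟨p, hp.tail hu⟩
  · rintro ⟨v, i⟩ hv
    cases hs : H.succ v with
    | none => simp [unitStep, hsucc v hv, hs]
    | some u =>
      have := hwt v hv (by simp [hs])
      by_cases hi : i + 1 < H.wt v <;> simp [unitStep, hsucc v hv, hs, this, hi]

theorem Homeo.sameWalks {H H' : Heap P} (h : Homeo H H') :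
    SameWalks H H.start H' H'.start := by
  obtain ⟨S, S', hS, hS', hiso⟩ := h
  exact (hS.sameWalks.trans hiso.sameWalks).trans hS'.sameWalks.symm

/-- Every edge has weight one. -/
def IsUnit (H : Heap P) : Prop := ∀ v, H.succ v ≠ none → H.wt v = 1

/-- The subdivision of the edge from `u` to `v` at distance one by the vertex `q`. -/
def split (H : Heap P) (u v q : ℕ) (huv : H.succ u = some v) (hw : 2 ≤ H.wt u)
    (hu : u ∈ H.V) : Heap P where
  V := insert q H.V
  succ := Function.update (Function.update H.succ u (some q)) q (some v)
  wt := Function.update (Function.update H.wt u 1) q (H.wt u - 1)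
  L := H.L
  label_mem p := Finset.mem_insert_of_mem (H.label_mem p)
  succ_mem w hw z hz := by
    have := H.succ_mem w
    have := H.succ_mem u hu v huv
    simp only [Function.update_apply] at hz
    grind
  succ_dom w hw := by
    have := H.succ_dom w
    simp only [Function.update_apply]
    grind
  wt_pos w hw hs := by
    have := H.wt_pos w
    simp only [Function.update_apply] at hs ⊢
    grind

theorem exists_subdiv_isUnit (H : Heap P) : ∃ S, H.Subdiv S ∧ S.IsUnit := by
  induction hn : ∑ v ∈ H.V, (H.wt v - 1) using Nat.strong_induction_on generalizing H with
  | _ n ih =>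
  subst hn
  by_cases hH : H.IsUnit
  · exact ⟨H, .refl, hH⟩
  simp only [IsUnit, not_forall] at hH
  obtain ⟨u, hs, hw⟩ := hH
  have hu : u ∈ H.V := by
    by_contra h
    exact hs (H.succ_dom u h)
  obtain ⟨v, huv⟩ := Option.ne_none_iff_exists'.1 hs
  have hw2 : 2 ≤ H.wt u := by have := H.wt_pos u hu hs; omega
  obtain ⟨q, hq⟩ := Infinite.exists_notMem_finset H.V
  have huq : u ≠ q := fun h => hq (h ▸ hu)
  have hlt : ∑ w ∈ (H.split u v q huv hw2 hu).V, ((H.split u v q huv hw2 hu).wt w - 1) <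
      ∑ w ∈ H.V, (H.wt w - 1) := by
    simp only [split]
    rw [Finset.sum_insert hq, ← Finset.add_sum_erase _ _ hu, ← Finset.add_sum_erase H.V _ hu]
    have : ∑ w ∈ H.V.erase u,
        (Function.update (Function.update H.wt u 1) q (H.wt u - 1) w - 1) =
        ∑ w ∈ H.V.erase u, (H.wt w - 1) := by
      refine Finset.sum_congr rfl fun w hw => ?_
      have hwq : w ≠ q := fun h => hq (h ▸ Finset.mem_of_mem_erase hw)
      simp [hwq, Finset.ne_of_mem_erase hw]
    simp only [this, Function.update_self, Function.update_of_ne huq]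
    omega
  obtain ⟨S, hS, hunit⟩ := ih _ hlt _ rfl
  have hsub : SingleSubdiv H (H.split u v q huv hw2 hu) :=
    ⟨u, v, q, 1, hu, huv, hw2, le_rfl, hw2, hq, rfl, rfl, rfl, rfl⟩
  exact ⟨S, .head hsub hS, hunit⟩

theorem IsUnit.unitStep_eq {H : Heap P} (h : H.IsUnit) (v : ℕ) :
    H.unitStep (v, 0) = (H.succ v).map fun u => (u, 0) := by
  cases hs : H.succ v with
  | none => simp [unitStep, hs]
  | some u => simp [unitStep, hs, h v (by simp [hs])]

theorem IsUnit.snd_eq_zero {H : Heap P} (h : H.IsUnit) {p : P} {n : ℕ} {s : ℕ × ℕ}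
    (hs : H.unitWalk (H.start p) n = some s) : s.2 = 0 := by
  refine unitWalk_mem (W := {s | s.2 = 0}) ?_ (s := H.start p) rfl n s hs
  rintro ⟨v, i⟩ rfl t ht
  rw [h.unitStep_eq] at ht
  obtain ⟨u, -, rfl⟩ := Option.map_eq_some_iff.1 ht
  rfl

theorem IsUnit.reachable_iff {H : Heap P} (h : H.IsUnit) {v : ℕ} :
    H.Reachable v ↔ ∃ p n, H.unitWalk (H.start p) n = some (v, 0) := by
  constructor
  · rintro ⟨p, hp⟩
    refine ⟨p, ?_⟩
    induction hp with
    | refl => exact ⟨0, rfl⟩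
    | tail _ hbc ih =>
      obtain ⟨n, hn⟩ := ih
      exact ⟨n + 1, by simp [unitWalk, hn, h.unitStep_eq, hbc]⟩
  · rintro ⟨p, n, hn⟩
    refine unitWalk_mem (W := {s | H.Reachable s.1}) ?_ (s := H.start p) ⟨p, .refl⟩ n _ hn
    rintro ⟨v, i⟩ ⟨p, hp⟩ t ht
    obtain ⟨u, hu, rfl⟩ := Option.map_eq_some_iff.1 ht
    split_ifs
    · exact ⟨p, hp⟩
    · exact ⟨p, hp.tail hu⟩

theorem SameWalks.iso {H H' : Heap P} (h : SameWalks H H.start H' H'.start)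
    (hH : H.IsUnit) (hH' : H'.IsUnit) : Iso H H' := by
  have hex : ∀ v, ∃ v', ∀ p n, H.unitWalk (H.start p) n = some (v, 0) →
      H'.unitWalk (H'.start p) n = some (v', 0) := by
    intro v
    by_cases hv : ∃ p n, H.unitWalk (H.start p) n = some (v, 0)
    · obtain ⟨p, n, hn⟩ := hv
      have hne : H'.unitWalk (H'.start p) n ≠ none := by simp [← h.2, hn]
      obtain ⟨⟨v', i⟩, hv'⟩ := Option.ne_none_iff_exists'.1 hne
      obtain rfl : i = 0 := hH'.snd_eq_zero hv'
      exact ⟨v', fun q m hm => ((h.1 q m p n).1 (hm.trans hn.symm)).trans hv'⟩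
    · exact ⟨0, fun p n hn => (hv ⟨p, n, hn⟩).elim⟩
  choose f hf using hex
  have hsucc : ∀ v, H.Reachable v → H'.succ (f v) = Option.map f (H.succ v) := by
    intro v hv
    obtain ⟨p, n, hn⟩ := hH.reachable_iff.1 hv
    have hwalk : H.unitWalk (H.start p) (n + 1) = (H.succ v).map fun u => (u, 0) := by
      simp [unitWalk, hn, hH.unitStep_eq]
    have hwalk' : H'.unitWalk (H'.start p) (n + 1) = (H'.succ (f v)).map fun u => (u, 0) := by
      simp [unitWalk, hf v p n hn, hH'.unitStep_eq]
    cases hs : H.succ v with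
    | none =>
      rw [hs] at hwalk
      have := (h.2 p (n + 1)).1 hwalk
      simpa [hwalk'] using this
    | some u =>
      rw [hs] at hwalk
      have := hf u p (n + 1) hwalk
      simpa [hwalk'] using this
  refine ⟨f, ⟨?_, ?_, ?_⟩, ?_, hsucc, ?_⟩
  · intro v hv
    obtain ⟨p, n, hn⟩ := hH.reachable_iff.1 hv
    exact hH'.reachable_iff.2 ⟨p, n, hf v p n hn⟩
  · intro v hv w hw hvw
    obtain ⟨p, n, hn⟩ := hH.reachable_iff.1 hv
    obtain ⟨q, m, hm⟩ := hH.reachable_iff.1 hw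
    have := (h.1 p n q m).2 (by rw [hf v p n hn, hf w q m hm, hvw])
    simpa [hn, hm] using this
  · intro v' hv'
    obtain ⟨p, n, hn'⟩ := hH'.reachable_iff.1 hv'
    have hne : H.unitWalk (H.start p) n ≠ none := by simp [h.2, hn']
    obtain ⟨⟨v, i⟩, hn⟩ := Option.ne_none_iff_exists'.1 hne
    obtain rfl : i = 0 := hH.snd_eq_zero hn
    refine ⟨v, hH.reachable_iff.2 ⟨p, n, hn⟩, ?_⟩
    simpa [hn'] using (hf v p n hn).symm
  · intro p
    simpa [unitWalk, start] using (hf (H.L p) p 0 rfl).symm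
  · intro v hv hs
    rw [hH v hs, hH' (f v) (by simpa [hsucc v hv] using hs)]

theorem SameWalks.homeo {H H' : Heap P} (h : SameWalks H H.start H' H'.start) :
    Homeo H H' := by
  obtain ⟨S, hS, hunit⟩ := H.exists_subdiv_isUnit
  obtain ⟨S', hS', hunit'⟩ := H'.exists_subdiv_isUnit
  exact ⟨S, S', hS, hS', ((hS.sameWalks.symm.trans h).trans hS'.sameWalks).iso hunit hunit'⟩

/-- Advancing one family member by a unit step preserves the pattern of unit walks. -/
theorem SameWalks.update [DecidableEq P] {H H' : Heap P} {a a' : P → ℕ × ℕ}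
    (h : SameWalks H a H' a') {x y : P} {t t' : ℕ × ℕ} (ht : H.unitStep (a y) = some t)
    (ht' : H'.unitStep (a' y) = some t') :
    SameWalks H (Function.update a x t) H' (Function.update a' x t') := by
  have key : ∀ p, ∃ q d, ∀ n, H.unitWalk (Function.update a x t p) n = H.unitWalk (a q) (n + d) ∧
      H'.unitWalk (Function.update a' x t' p) n = H'.unitWalk (a' q) (n + d) := by
    intro p
    by_cases hp : p = x
    · subst hp
      exact ⟨y, 1, fun n => by
        simp [unitWalk_succ_of_unitStep ht, unitWalk_succ_of_unitStep ht']⟩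
    · exact ⟨p, 0, fun n => by simp [hp]⟩
  choose q d hqd using key
  refine ⟨fun p m p' n => ?_, fun p m => ?_⟩
  · rw [(hqd p m).1, (hqd p m).2, (hqd p' n).1, (hqd p' n).2]
    exact h.1 _ _ _ _
  · rw [(hqd p m).1, (hqd p m).2]
    exact h.2 _ _

/-- Looking up `y` into `x` moves `x` to the state one unit step after `y`. -/
theorem IsLookup.exists_sameWalks [DecidableEq P] {H H' : Heap P} {x y : P}
    (h : H.IsLookup x y H') : ∃ t, H.unitStep (H.start y) = some t ∧
      SameWalks H (Function.update H.start x t) H' H'.start := by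
  obtain ⟨u, hu, ⟨hw, -, hsucc, hwt, hL⟩ | ⟨hw, q, hq, -, hsucc, hwt, hL⟩⟩ := h
  · refine ⟨(u, 0), by simp [unitStep, start, hu, hw], ?_⟩
    refine sameWalks_of_map (W := Set.univ) (g := id) (Set.injOn_id _)
      (fun _ _ _ _ => trivial) (fun s _ => by simp [unitStep, hsucc, hwt])
      (fun _ => trivial) fun p => ?_
    by_cases hp : p = x
    · subst hp; simp [start, hL]
    · simp [start, hL, hp]
  · have hw' : 1 < H.wt (H.L y) := hw
    refine ⟨(H.L y, 1), by simp [unitStep, start, hu, hw'], ?_⟩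
    refine sameWalks_of_split (H.label_mem y) hu le_rfl hw hq hsucc hwt (fun p => ?_) fun p => ?_
    · by_cases hp : p = x
      · subst hp; simpa using H.label_mem y
      · simpa [hp, start] using H.label_mem p
    · by_cases hp : p = x
      · subst hp; simp [start, hL, splitState]
      · simp [start, hL, hp, splitState]

end Heap

/-- The `lookup` case of the paper's Lemma "Transformers Respect Homeomorphism":
if `H₁ ∼ H₂` and `L y` has a successor in both heaps, then the results of
`lookup(H₁, x, y)` and `lookup(H₂, x, y)` are homeomorphic. -/
theorem lookup_respects_homeo {P : Type} [DecidableEq P] (H₁ H₂ : Heap P)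
    (x y : P) (hhom : H₁.Homeo H₂)
    (h₁ : H₁.succ (H₁.L y) ≠ none) (h₂ : H₂.succ (H₂.L y) ≠ none)
    (H₁' H₂' : Heap P)
    (l₁ : H₁.IsLookup x y H₁') (l₂ : H₂.IsLookup x y H₂') :
    H₁'.Homeo H₂' := by
  obtain ⟨t₁, ht₁, hw₁⟩ := l₁.exists_sameWalks
  obtain ⟨t₂, ht₂, hw₂⟩ := l₂.exists_sameWalks
  exact ((hw₁.symm.trans (hhom.sameWalks.update ht₁ ht₂)).trans hw₂).homeo
end

section
/- Let H₁ and H₂ be homeomorphic heaps over P and let x, y ∈ P be pointer variables. Then update(H₁, x, y) and update(H₂, x, y) are homeomorphic. -/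
/-- The transformer `update(H, x, y)`: set the successor of `L x` to `L y`
with weight 1; everything else unchanged. -/
def Heap.IsUpdate {P : Type} [DecidableEq P] (H : Heap P) (x y : P) (H' : Heap P) : Prop :=
  H'.V = H.V ∧ H'.L = H.L ∧
  H'.succ = Function.update H.succ (H.L x) (some (H.L y)) ∧
  H'.wt = Function.update H.wt (H.L x) 1

namespace Heap

variable {P : Type}

/-- `T` is a part of `S` closed under successors, up to the edge out of `S.L x`, which `T`
redirects to `S.L y` with weight 1. -/
structure PartialUpdate (S : Heap P) (x y : P) (T : Heap P) : Prop where
  subset : T.V ⊆ S.V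
  label : T.L = S.L
  succ_eq : ∀ v ∈ T.V, T.succ v = Function.update S.succ (S.L x) (some (S.L y)) v
  wt_eq : ∀ v ∈ T.V, T.wt v = Function.update S.wt (S.L x) 1 v

theorem Reachable.label (H : Heap P) (p : P) : H.Reachable (H.L p) :=
  ⟨p, .refl⟩

theorem Reachable.step {H : Heap P} {v w : ℕ} (hv : H.Reachable v) (h : H.succ v = some w) :
    H.Reachable w :=
  hv.imp fun _ hp => hp.tail h

theorem Reachable.induction {H : Heap P} {C : ℕ → Prop} (label : ∀ p, C (H.L p))
    (step : ∀ v w, H.Reachable v → C v → H.succ v = some w → C w) {v : ℕ}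
    (hv : H.Reachable v) : C v := by
  obtain ⟨p, hp⟩ := hv
  induction hp with
  | refl => exact label p
  | tail hab hbc ih => exact step _ _ ⟨p, hab⟩ ih hbc

theorem Reachable.mem {H : Heap P} {v : ℕ} (hv : H.Reachable v) : v ∈ H.V :=
  hv.induction H.label_mem fun _ _ _ hv h => H.succ_mem _ hv _ h

/-- A map that is injective on reachable vertices and respects labels, successors and weights
is automatically onto the reachable vertices. -/
theorem Iso.of_injOn {H H' : Heap P} (f : ℕ → ℕ) (inj : Set.InjOn f {v | H.Reachable v})
    (label : ∀ p, f (H.L p) = H'.L p)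
    (succ : ∀ v, H.Reachable v → H'.succ (f v) = Option.map f (H.succ v))
    (wt : ∀ v, H.Reachable v → H.succ v ≠ none → H'.wt (f v) = H.wt v) : Iso H H' := by
  refine ⟨f, ⟨fun v hv => ?_, inj, fun w hw => ?_⟩, label, succ, wt⟩
  · refine Reachable.induction (C := fun v => H'.Reachable (f v)) (fun p => ?_)
      (fun v w hv ih h => ih.step ?_) hv
    · exact label p ▸ Reachable.label H' p
    · rw [succ v hv, h, Option.map_some]
  · refine Reachable.induction (C := fun w => w ∈ f '' {v | H.Reachable v}) (fun p => ?_) ?_ hw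
    · exact ⟨H.L p, Reachable.label H p, label p⟩
    · rintro _ w - ⟨v, hv, rfl⟩ h
      rw [succ v hv, Option.map_eq_some_iff] at h
      obtain ⟨u, hu, rfl⟩ := h
      exact ⟨u, Reachable.step hv hu, rfl⟩

/-- Subdivide the edge from `u` to `v` by a vertex `q`, giving the first half weight `k`. -/
def subdivide (H : Heap P) (u v q k : ℕ) (hu : u ∈ H.V) (huv : H.succ u = some v)
    (hk : 1 ≤ k) (hkn : k < H.wt u) : Heap P where
  V := insert q H.V
  succ := Function.update (Function.update H.succ u (some q)) q (some v)
  wt := Function.update (Function.update H.wt u k) q (H.wt u - k)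
  L := H.L
  label_mem p := Finset.mem_insert_of_mem (H.label_mem p)
  succ_mem w hw z hz := by
    have := H.succ_mem
    grind [Function.update_apply]
  succ_dom w hw := by
    have := H.succ_dom
    grind [Function.update_apply]
  wt_pos w hw hz := by
    have := H.wt_pos
    grind [Function.update_apply]

namespace PartialUpdate

variable {S T : Heap P} {x y : P}

/-- A subdivision step of `S` is matched by at most one subdivision step of `T`: the edge out
of `S.L x` and the edges outside `T` are ignored. -/
theorem singleSubdiv {S' : Heap P} (h : S.PartialUpdate x y T) (hS : SingleSubdiv S S') :
    ∃ T', T.Subdiv T' ∧ S'.PartialUpdate x y T' := by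
  obtain ⟨u, v, q, k, hu, huv, hn, hk, hkn, hq, hV, hsucc, hwt, hL⟩ := hS
  have hsub := h.subset
  have hs := h.succ_eq
  have hw := h.wt_eq
  have hx := S.label_mem x
  by_cases hc : u ∈ T.V ∧ u ≠ S.L x
  · obtain ⟨huT, hux⟩ := hc
    have hsT : T.succ u = some v := by rw [hs u huT, Function.update_of_ne hux, huv]
    have hwT : T.wt u = S.wt u := by rw [hw u huT, Function.update_of_ne hux]
    have hqT : q ∉ T.V := fun hm => hq (hsub hm)
    refine ⟨T.subdivide u v q k huT hsT hk (hwT ▸ hkn), .single ⟨u, v, q, k, huT, hsT,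
      hwT ▸ hn, hk, hwT ▸ hkn, hqT, rfl, rfl, rfl, rfl⟩, ?_, ?_, ?_, ?_⟩
    · rw [hV]
      exact Finset.insert_subset_insert _ hsub
    · exact h.label.trans hL.symm
    · intro w hm
      simp only [subdivide, hsucc, hL, Function.update_apply] at hm hs ⊢
      grind
    · intro w hm
      simp only [subdivide, hwt, hL, Function.update_apply] at hm hw ⊢
      grind
  · refine ⟨T, .refl, ?_, h.label.trans hL.symm, ?_, ?_⟩
    · rw [hV]
      exact hsub.trans (Finset.subset_insert _ _)
    · intro w hm
      simp only [hsucc, hL, Function.update_apply] at hs ⊢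
      grind
    · intro w hm
      simp only [hwt, hL, Function.update_apply] at hw ⊢
      grind

theorem subdiv {S' : Heap P} (h : S.PartialUpdate x y T) (hS : S.Subdiv S') :
    ∃ T', T.Subdiv T' ∧ S'.PartialUpdate x y T' := by
  induction hS with
  | refl => exact ⟨T, .refl, h⟩
  | tail _ hstep ih =>
    obtain ⟨T₁, hT₁, h₁⟩ := ih
    obtain ⟨T₂, hT₂, h₂⟩ := h₁.singleSubdiv hstep
    exact ⟨T₂, hT₁.trans hT₂, h₂⟩

theorem reachable (h : S.PartialUpdate x y T) {v : ℕ} (hv : T.Reachable v) : S.Reachable v := by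
  refine hv.induction (fun p => h.label ▸ Reachable.label S p) fun v w hvT hvS hvw => ?_
  rw [h.succ_eq v hvT.mem] at hvw
  by_cases hvx : v = S.L x
  · rw [hvx, Function.update_self, Option.some_inj] at hvw
    exact hvw ▸ Reachable.label S y
  · rw [Function.update_of_ne hvx] at hvw
    exact hvS.step hvw

theorem iso {S₁ S₂ T₁ T₂ : Heap P} (h₁ : S₁.PartialUpdate x y T₁)
    (h₂ : S₂.PartialUpdate x y T₂) (hS : Iso S₁ S₂) : Iso T₁ T₂ := by
  obtain ⟨f, hf, label, succ, wt⟩ := hS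
  have label' : ∀ p, f (T₁.L p) = T₂.L p := by
    rw [h₁.label, h₂.label]
    exact label
  have ne : ∀ v, T₁.Reachable v → v ≠ S₁.L x → f v ≠ S₂.L x := fun v hv hvx hfv =>
    hvx (hf.injOn (h₁.reachable hv) (Reachable.label S₁ x) (hfv.trans (label x).symm))
  have succ' : ∀ v, T₁.Reachable v → f v ∈ T₂.V →
      T₂.succ (f v) = Option.map f (T₁.succ v) := by
    intro v hv hm
    rw [h₂.succ_eq _ hm, h₁.succ_eq _ hv.mem]
    by_cases hvx : v = S₁.L x
    · rw [hvx, label, Function.update_self, Function.update_self, Option.map_some, label]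
    · rw [Function.update_of_ne hvx, Function.update_of_ne (ne v hv hvx),
        succ v (h₁.reachable hv)]
  have mem : ∀ v, T₁.Reachable v → f v ∈ T₂.V := fun v hv =>
    hv.induction (C := fun v => f v ∈ T₂.V) (fun p => label' p ▸ T₂.label_mem p)
      fun v w hv hm h => T₂.succ_mem _ hm _ (by rw [succ' v hv hm, h, Option.map_some])
  refine Iso.of_injOn f (hf.injOn.mono fun v hv => h₁.reachable hv) label'
    (fun v hv => succ' v hv (mem v hv)) fun v hv hne => ?_
  rw [h₂.wt_eq _ (mem v hv), h₁.wt_eq _ hv.mem]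
  by_cases hvx : v = S₁.L x
  · rw [hvx, label, Function.update_self, Function.update_self]
  · rw [h₁.succ_eq _ hv.mem, Function.update_of_ne hvx] at hne
    rw [Function.update_of_ne hvx, Function.update_of_ne (ne v hv hvx),
      wt v (h₁.reachable hv) hne]

end PartialUpdate

theorem IsUpdate.partialUpdate [DecidableEq P] {H H' : Heap P} {x y : P}
    (h : H.IsUpdate x y H') : H.PartialUpdate x y H' := by
  obtain ⟨hV, hL, hsucc, hwt⟩ := h
  exact ⟨hV.le, hL, fun v _ => congrFun hsucc v, fun v _ => congrFun hwt v⟩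

end Heap


/-- The `update` case of the paper's Lemma "Transformers Respect Homeomorphism":
if `H₁ ∼ H₂` then the results of `update(H₁, x, y)` and `update(H₂, x, y)` are
homeomorphic. -/
theorem update_respects_homeo {P : Type} [DecidableEq P] (H₁ H₂ : Heap P)
    (x y : P) (hhom : H₁.Homeo H₂)
    (H₁' H₂' : Heap P)
    (u₁ : H₁.IsUpdate x y H₁') (u₂ : H₂.IsUpdate x y H₂') :
    H₁'.Homeo H₂' := by
  obtain ⟨S₁, S₂, hS₁, hS₂, hS⟩ := hhom
  obtain ⟨T₁, hT₁, h₁⟩ := u₁.partialUpdate.subdiv hS₁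
  obtain ⟨T₂, hT₂, h₂⟩ := u₂.partialUpdate.subdiv hS₂
  exact ⟨T₁, T₂, hT₁, hT₂, h₁.iso h₂ hS⟩
end
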